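/- arXiv:1610.01028 — 2 statements merged into one kernel-verified Lean document; each statement's English description precedes it below -/
import Mathlib

section
/- There exists a finite set V ⊆ ℝ⁴ such that the polytope P = convexHull ℝ V has exactly 12 proper faces of dimension 0, 39 of dimension 1, 39 of dimension 2, and 12 of dimension 3; that is, (12,39,39,12) is the f-vector of a convex 4-polytope. -/
open Module

/-- The number of proper faces of dimension `k` of the polytope `convexHull ℝ V`. -/
noncomputable def fVec (V : Set (EuclideanSpace ℝ (Fin 4))) (k : ℕ) : ℕ :=
  {F : Set (EuclideanSpace ℝ (Fin 4)) | F ≠ ∅ ∧ F ≠ convexHull ℝ V ∧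
    IsExposed ℝ (convexHull ℝ V) F ∧ finrank ℝ (vectorSpan ℝ F) = k}.ncard

namespace Poly

def vz : Fin 12 → Fin 4 → ℤ :=
  ![![-2, -1, -3, -1],
    ![-2, -1, 1, -1],
    ![-2, -1, 2, 1],
    ![-1, 0, 2, 2],
    ![0, -1, -2, 0],
    ![1, -1, -1, 1],
    ![1, -1, 1, -2],
    ![1, -1, 1, 2],
    ![1, 1, 0, -2],
    ![1, 2, -2, -1],
    ![1, 2, -1, -2],
    ![1, 2, 2, 3]]

/-- Facets: vertex mask, outer normal, right-hand side. -/
def facets : List (ℕ × (Fin 4 → ℤ) × ℤ) :=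
  [(3599, ![-1, 1, 0, 0], 1),
    (247, ![0, -1, 0, 0], 1),
    (1347, ![-1, 0, 0, -3], 5),
    (141, ![-7, -8, -6, 15], 25),
    (2217, ![-2, -1, -3, 6], 8),
    (2609, ![0, 1, -3, 3], 5),
    (1617, ![3, -2, -3, -3], 8),
    (2374, ![-1, 3, 6, -3], 8),
    (3330, ![-8, 15, 15, -9], 25),
    (2252, ![1, -1, 3, 0], 5),
    (624, ![15, -7, -9, -6], 25),
    (4064, ![1, 0, 0, 0], 1)]

/-- Faces of each dimension, as vertex masks. -/
def L : Fin 4 → List ℕ :=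
  ![[1, 2, 4, 8, 16, 32, 64, 128, 256, 512, 1024, 2048],
    [3, 5, 6, 9, 12, 17, 33, 48, 65, 66, 68, 80, 96, 129, 132, 136, 160, 192, 258, 320, 513, 528, 544, 576, 1025, 1026, 1088, 1280, 1536, 2049, 2050, 2052, 2056, 2080, 2112, 2176, 2304, 2560, 3072],
    [7, 13, 49, 67, 70, 81, 112, 133, 137, 140, 161, 196, 224, 322, 529, 560, 592, 608, 1027, 1089, 1282, 1344, 1537, 1600, 2054, 2057, 2060, 2081, 2116, 2184, 2208, 2240, 2306, 2368, 2561, 2592, 3074, 3328, 3584],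
    [141, 247, 624, 1347, 1617, 2217, 2252, 2374, 2609, 3330, 3599, 4064]]

/-- Affine dependences: positive mask, negative mask, coefficients. -/
def circs : List (ℕ × ℕ × (Fin 12 → ℤ)) :=
  [(24, 2181, ![-2, 0, -1, 3, 3, 0, 0, -2, 0, 0, 0, -1]),
    (516, 1033, ![-9, 0, 23, -21, 0, 0, 0, 0, 0, 24, -17, 0]),
    (1152, 2624, ![0, 0, 0, 0, 0, 0, -2, 2, 0, -3, 4, -1]),
    (288, 1216, ![0, 0, 0, 0, 0, 4, -9, -3, 24, 0, -16, 0]),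
    (514, 1029, ![-3, 7, -4, 0, 0, 0, 0, 0, 0, 8, -8, 0]),
    (2064, 545, ![-4, 0, 0, 0, 12, -8, 0, 0, 0, -1, 0, 1]),
    (72, 2180, ![0, 0, -8, 12, 0, 0, 1, -1, 0, 0, 0, -4]),
    (257, 1090, ![1, -1, 0, 0, 0, 0, -4, 0, 12, 0, -8, 0]),
    (36, 144, ![0, 0, 1, 0, -3, 5, 0, -3, 0, 0, 0, 0]),
    (130, 100, ![0, 8, -8, 0, 0, -4, -3, 7, 0, 0, 0, 0]),
    (1028, 2562, ![0, -8, 8, 0, 0, 0, 0, 0, 0, -1, 4, -3]),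
    (1056, 768, ![0, 0, 0, 0, 0, 1, 0, 0, -3, -3, 5, 0]),
    (640, 3104, ![0, 0, 0, 0, 0, -8, 0, 8, 0, 7, -4, -3]),
    (260, 2114, ![0, -5, 5, 0, 0, 0, -1, 0, 3, 0, 0, -2]),
    (18, 193, ![-9, 5, 0, 0, 12, 0, -3, -5, 0, 0, 0, 0]),
    (10, 1028, ![0, 3, -5, 3, 0, 0, 0, 0, 0, 0, -1, 0]),
    (144, 35, ![-3, -1, 0, 0, 12, -12, 0, 4, 0, 0, 0, 0]),
    (2113, 642, ![1, -1, 0, 0, 0, 0, 1, -1, 0, -1, 0, 1]),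
    (768, 1056, ![0, 0, 0, 0, 0, -1, 0, 0, 3, 3, -5, 0]),
    (520, 2051, ![-3, -5, 0, 12, 0, 0, 0, 0, 0, 5, 0, -9]),
    (1040, 577, ![-1, 0, 0, 0, 3, 0, -2, 0, 0, -5, 5, 0]),
    (34, 193, ![-2, 2, 0, 0, 0, 4, -1, -3, 0, 0, 0, 0]),
    (40, 2177, ![-2, 0, 0, 3, 0, 5, 0, -5, 0, 0, 0, -1]),
    (264, 3138, ![0, -2, 0, 3, 0, 0, -1, 0, 3, 0, -1, -2]),
    (2177, 40, ![2, 0, 0, -3, 0, -5, 0, 5, 0, 0, 0, 1]),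
    (577, 1040, ![1, 0, 0, 0, -3, 0, 2, 0, 0, 5, -5, 0]),
    (2114, 260, ![0, 5, -5, 0, 0, 0, 1, 0, -3, 0, 0, 2]),
    (69, 130, ![1, -5, 4, 0, 0, 0, 2, -2, 0, 0, 0, 0]),
    (3073, 514, ![2, -2, 0, 0, 0, 0, 0, 0, 0, -5, 4, 1]),
    (384, 2624, ![0, 0, 0, 0, 0, 0, -9, 5, 12, -5, 0, -3]),
    (2624, 1152, ![0, 0, 0, 0, 0, 0, 2, -2, 0, 3, -4, 1]),
    (1032, 2051, ![-1, -7, 0, 12, 0, 0, 0, 0, 0, 0, 4, -8]),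
    (1090, 257, ![-1, 1, 0, 0, 0, 0, 4, 0, -12, 0, 8, 0]),
    (20, 193, ![-8, 0, 4, 0, 12, 0, -1, -7, 0, 0, 0, 0]),
    (545, 2064, ![4, 0, 0, 0, -12, 8, 0, 0, 0, 1, 0, -1]),
    (2180, 72, ![0, 0, 8, -12, 0, 0, -1, 1, 0, 0, 0, 4]),
    (2053, 10, ![1, -5, 20, -24, 0, 0, 0, 0, 0, 0, 0, 8]),
    (97, 144, ![8, 0, 0, 0, -24, 20, 1, -5, 0, 0, 0, 0]),
    (272, 609, ![-1, 0, 0, 0, 3, -1, -2, 0, 3, -2, 0, 0]),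
    (2144, 640, ![0, 0, 0, 0, 0, 4, 1, -5, 0, -2, 0, 2]),
    (3136, 768, ![0, 0, 0, 0, 0, 0, 8, 0, -24, -5, 20, 1]),
    (2051, 516, ![1, 3, -4, 0, 0, 0, 0, 0, 0, -2, 0, 2]),
    (193, 34, ![2, -2, 0, 0, 0, -4, 1, 3, 0, 0, 0, 0])]

abbrev E := EuclideanSpace ℝ (Fin 4)

/-- Sum of the normals of the facets containing the face `s`. -/
def nrm (s : ℕ) : Fin 4 → ℤ := fun k =>
  ((facets.filter (fun f => f.1 &&& s == s)).map (fun f => f.2.1 k)).sum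

def rhs (s : ℕ) : ℤ := ((facets.filter (fun f => f.1 &&& s == s)).map (fun f => f.2.2)).sum

def dot (a : Fin 4 → ℤ) (i : Fin 12) : ℤ :=
  a 0 * vz i 0 + a 1 * vz i 1 + a 2 * vz i 2 + a 3 * vz i 3

theorem chk_exp : ∀ k : Fin 4, ∀ s ∈ L k, ∀ i : Fin 12,
    if s.testBit i then dot (nrm s) i = rhs s else dot (nrm s) i < rhs s := by
  decide +kernel

theorem chk_ne : ∀ k : Fin 4, ∀ s ∈ L k, (∃ i : Fin 12, s.testBit i = true) ∧
    (∃ i : Fin 12, s.testBit i = false) ∧ s < 4096 := by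
  decide +kernel

theorem chk_down : ∀ k : Fin 3, ∀ s ∈ L k.succ, ∃ t ∈ L k.castSucc, t ≠ s ∧ t &&& s = t := by
  decide +kernel

theorem chk_up : ∀ k : Fin 3, ∀ s ∈ L k.castSucc, ∃ t ∈ L k.succ, s ≠ t ∧ s &&& t = s := by
  decide +kernel

theorem chk_circ : ∀ c ∈ circs, (∑ i, c.2.2 i = 0) ∧ (∀ k : Fin 4, ∑ i, c.2.2 i * vz i k = 0) ∧
    (∀ i : Fin 12, (c.1.testBit i = true ↔ 0 < c.2.2 i)) ∧
    (∀ i : Fin 12, (c.2.1.testBit i = true ↔ c.2.2 i < 0)) ∧ c.1 < 4096 ∧ c.2.1 < 4096 := by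
  decide +kernel

def closedB (s : ℕ) : Bool := circs.all (fun c => !(c.1 &&& s == c.1) || (c.2.1 &&& s == c.2.1))

def inL (s : ℕ) : Bool :=
  (L 0).contains s || (L 1).contains s || (L 2).contains s || (L 3).contains s

theorem chk_closed : ∀ s < 4096, closedB s = true → s = 0 ∨ s = 4095 ∨ inL s = true := by
  have : (List.range 4096).all
      (fun s => !(closedB s) || (s == 0 || (s == 4095 || inL s))) = true := by
    decide +kernel
  intro s hs hc
  have h := List.all_eq_true.1 this s (List.mem_range.2 hs)
  simpa [hc] using h

theorem chk_len : (L 0).length = 12 ∧ (L 1).length = 39 ∧ (L 2).length = 39 ∧ (L 3).length = 12 ∧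
    ∀ k, (L k).Nodup := by
  decide +kernel

noncomputable def v (i : Fin 12) : E := WithLp.toLp 2 (fun k => (vz i k : ℝ))

noncomputable def lf (a : Fin 4 → ℤ) : E →L[ℝ] ℝ :=
  ∑ k, (a k : ℝ) • (EuclideanSpace.proj k : E →L[ℝ] ℝ)

theorem lf_v (a : Fin 4 → ℤ) (i : Fin 12) : lf a (v i) = (dot a i : ℝ) := by
  simp [lf, v, dot, Fin.sum_univ_four]

def idx (s : ℕ) : Set (Fin 12) := {i | s.testBit i = true}

def face (s : ℕ) : Set E := convexHull ℝ (v '' idx s)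

def P : Set E := convexHull ℝ (Set.range v)

theorem le_of_mem {l : E →L[ℝ] ℝ} {m : ℝ} (h : ∀ i, l (v i) ≤ m) {x : E} (hx : x ∈ P) :
    l x ≤ m := by
  have : P ⊆ {x | l x ≤ m} := by
    refine convexHull_min ?_ (convex_halfSpace_le l.toLinearMap.isLinear m)
    rintro _ ⟨i, rfl⟩
    exact h i
  exact this hx

theorem eq_of_mem {l : E →L[ℝ] ℝ} {m : ℝ} {s : ℕ} (h : ∀ i ∈ idx s, l (v i) = m) {x : E}
    (hx : x ∈ face s) : l x = m := by
  have : face s ⊆ {x | l x = m} := by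
    refine convexHull_min ?_ (convex_hyperplane l.toLinearMap.isLinear m)
    rintro _ ⟨i, hi, rfl⟩
    exact h i hi
  exact this hx

theorem face_sub (s : ℕ) : face s ⊆ P := convexHull_mono (Set.image_subset_range _ _)

theorem argmax (l : E →L[ℝ] ℝ) (m : ℝ) (s : ℕ) (h1 : ∀ i ∈ idx s, l (v i) = m)
    (h2 : ∀ i ∉ idx s, l (v i) < m) (hne : (idx s).Nonempty) :
    face s = {x ∈ P | ∀ y ∈ P, l y ≤ l x} := by
  have hle : ∀ i, l (v i) ≤ m := fun i => by
    by_cases hi : i ∈ idx s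
    · exact (h1 i hi).le
    · exact (h2 i hi).le
  apply Set.Subset.antisymm
  · intro x hx
    refine ⟨face_sub s hx, fun y hy => ?_⟩
    rw [eq_of_mem h1 hx]
    exact le_of_mem hle hy
  · rintro x ⟨hx, hmax⟩
    obtain ⟨j, hj⟩ := hne
    have hlx : l x = m := by
      refine le_antisymm (le_of_mem hle hx) ?_
      rw [← h1 j hj]
      exact hmax _ (subset_convexHull ℝ _ ⟨j, rfl⟩)
    have hx' := hx
    rw [P, convexHull_range_eq_exists_affineCombination] at hx'
    obtain ⟨t, w, hw0, hw1, rfl⟩ := hx'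
    rw [Finset.affineCombination_eq_linear_combination _ _ _ hw1] at hlx ⊢
    have hz : ∀ i ∈ t, i ∉ idx s → w i = 0 := by
      have hsum : ∑ i ∈ t, w i * (m - l (v i)) = 0 := by
        simp only [map_sum, map_smul, smul_eq_mul] at hlx
        simp only [mul_sub, Finset.sum_sub_distrib, ← Finset.sum_mul, hw1, hlx]
        ring
      have := (Finset.sum_eq_zero_iff_of_nonneg (fun i hi =>
        mul_nonneg (hw0 i hi) (sub_nonneg.2 (hle i)))).1 hsum
      intro i hi his
      rcases mul_eq_zero.1 (this i hi) with h | h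
      · exact h
      · have := h2 i his
        linarith
    classical
    have e1 : ∑ i ∈ t, w i • v i = ∑ i ∈ t with i ∈ idx s, w i • v i := by
      refine (Finset.sum_filter_of_ne fun i hi hne => ?_).symm
      by_contra hc
      exact hne (by rw [hz i hi hc, zero_smul])
    have e2 : ∑ i ∈ t with i ∈ idx s, w i = 1 := by
      rw [← hw1]
      refine Finset.sum_filter_of_ne fun i hi hne => ?_
      by_contra hc
      exact hne (hz i hi hc)
    rw [e1]
    refine (convex_convexHull ℝ _).sum_mem (fun i hi => hw0 i (Finset.mem_filter.1 hi).1) e2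
      (fun i hi => subset_convexHull ℝ _ ⟨i, (Finset.mem_filter.1 hi).2, rfl⟩)

/-- the supporting functional of a listed face -/
theorem sup_fun {k : Fin 4} {s : ℕ} (hs : s ∈ L k) :
    (∀ i ∈ idx s, lf (nrm s) (v i) = rhs s) ∧ (∀ i ∉ idx s, lf (nrm s) (v i) < rhs s) := by
  constructor
  · intro i hi
    have h := chk_exp k s hs i
    rw [if_pos (show s.testBit i = true from hi)] at h
    rw [lf_v, h]
  · intro i hi
    have h := chk_exp k s hs i
    rw [if_neg (show ¬ s.testBit i = true from hi)] at h
    rw [lf_v]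
    exact_mod_cast h

theorem ne_idx {k : Fin 4} {s : ℕ} (hs : s ∈ L k) : (idx s).Nonempty := (chk_ne k s hs).1

theorem face_exposed {k : Fin 4} {s : ℕ} (hs : s ∈ L k) : IsExposed ℝ P (face s) := fun _ =>
  ⟨lf (nrm s), argmax _ _ s (sup_fun hs).1 (sup_fun hs).2 (ne_idx hs)⟩

theorem v_mem_face {k : Fin 4} {s : ℕ} (hs : s ∈ L k) (i : Fin 12) : v i ∈ face s ↔ i ∈ idx s := by
  constructor
  · intro h
    by_contra hi
    exact ((sup_fun hs).2 i hi).ne (eq_of_mem (sup_fun hs).1 h)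
  · exact fun h => subset_convexHull ℝ _ ⟨i, h, rfl⟩

theorem eq_of_idx {s t : ℕ} (hs : s < 4096) (ht : t < 4096) (h : idx s = idx t) : s = t := by
  apply Nat.eq_of_testBit_eq
  intro i
  by_cases hi : i < 12
  · have := Set.ext_iff.1 h ⟨i, hi⟩
    simp only [idx, Set.mem_ofPred_eq] at this
    exact Bool.eq_iff_iff.2 this
  · have h2 : 2 ^ 12 ≤ 2 ^ i := Nat.pow_le_pow_right (by norm_num) (by omega)
    rw [Nat.testBit_lt_two_pow (by omega), Nat.testBit_lt_two_pow (by omega)]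

theorem face_inj {k : Fin 4} : Set.InjOn face {s | s ∈ L k} := by
  intro s hs t ht h
  refine eq_of_idx (chk_ne k s hs).2.2 (chk_ne k t ht).2.2 ?_
  ext i
  rw [← v_mem_face hs, h, v_mem_face ht]

theorem face_ne_P {k : Fin 4} {s : ℕ} (hs : s ∈ L k) : face s ≠ P := by
  obtain ⟨i, hi⟩ := (chk_ne k s hs).2.1
  intro h
  have : v i ∈ face s := h ▸ subset_convexHull ℝ _ ⟨i, rfl⟩
  rw [v_mem_face hs] at this
  simp [idx, hi] at this

theorem face_ne_empty {k : Fin 4} {s : ℕ} (hs : s ∈ L k) : face s ≠ ∅ := by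
  obtain ⟨i, hi⟩ := ne_idx hs
  exact Set.Nonempty.ne_empty ⟨v i, (v_mem_face hs i).2 hi⟩

noncomputable def dm (F : Set E) : ℕ := finrank ℝ (vectorSpan ℝ F)

theorem dm_lt {k : Fin 4} {s : ℕ} (hs : s ∈ L k) {G : Set E} (hsub : face s ⊆ G)
    (hG : ∃ i, v i ∈ G ∧ i ∉ idx s) : dm (face s) < dm G := by
  obtain ⟨i, hi, his⟩ := hG
  obtain ⟨j, hj⟩ := ne_idx hs
  apply Submodule.finrank_lt_finrank_of_lt
  refine lt_of_le_of_ne (vectorSpan_mono ℝ hsub) fun heq => ?_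
  have hmem : v i -ᵥ v j ∈ vectorSpan ℝ (face s) := by
    rw [heq]
    exact vsub_mem_vectorSpan ℝ hi (hsub ((v_mem_face hs j).2 hj))
  have hker : vectorSpan ℝ (face s) ≤ LinearMap.ker (lf (nrm s)).toLinearMap := by
    rw [vectorSpan, Submodule.span_le]
    rintro _ ⟨x, hx, y, hy, rfl⟩
    have h1 := eq_of_mem (sup_fun hs).1 hx
    have h2 := eq_of_mem (sup_fun hs).1 hy
    simp [h1, h2]
  have h3 := hker hmem
  have h1 := (sup_fun hs).1 j hj
  have h2 := (sup_fun hs).2 i his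
  simp [h1] at h3
  linarith

theorem dm_lt' {k k' : Fin 4} {s t : ℕ} (hs : s ∈ L k) (ht : t ∈ L k') (hne : s ≠ t)
    (hst : s &&& t = s) : dm (face s) < dm (face t) := by
  have hsub : idx s ⊆ idx t := by
    intro i hi
    simp only [idx, Set.mem_ofPred_eq] at hi ⊢
    rw [← hst, Nat.testBit_land, Bool.and_eq_true] at hi
    exact hi.2
  refine dm_lt hs (convexHull_mono (Set.image_mono hsub)) ?_
  by_contra hc
  push Not at hc
  apply hne
  refine eq_of_idx (chk_ne k s hs).2.2 (chk_ne k' t ht).2.2 (Set.Subset.antisymm hsub ?_)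
  intro i hi
  exact hc i ((v_mem_face ht i).2 hi)

theorem dm_lower (k : Fin 4) : ∀ s ∈ L k, (k : ℕ) ≤ dm (face s) := by
  induction k using Fin.induction with
  | zero => intro s _; simp
  | succ k ih =>
    intro s hs
    obtain ⟨t, ht, hne, hts⟩ := chk_down k s hs
    have := dm_lt' ht hs hne hts
    have := ih t ht
    simp at this ⊢
    omega

theorem dm_upper (k : Fin 4) : ∀ s ∈ L k, dm (face s) ≤ k := by
  induction k using Fin.reverseInduction with
  | last =>
    intro s hs
    obtain ⟨i, hi⟩ := (chk_ne _ s hs).2.1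
    have h1 : dm (face s) < dm P := dm_lt hs (face_sub s)
      ⟨i, subset_convexHull ℝ _ ⟨i, rfl⟩, by simp [idx, hi]⟩
    have h2 : dm P ≤ 4 := by
      have := Submodule.finrank_le (vectorSpan ℝ P)
      simpa [dm] using this
    simp
    omega
  | cast k ih =>
    intro s hs
    obtain ⟨t, ht, hne, hts⟩ := chk_up k s hs
    have := dm_lt' hs ht hne hts
    have := ih t ht
    simp at this ⊢
    omega

theorem dm_eq {k : Fin 4} {s : ℕ} (hs : s ∈ L k) : finrank ℝ (vectorSpan ℝ (face s)) = k :=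
  le_antisymm (dm_upper k s hs) (dm_lower k s hs)

theorem land_eq_of {a s : ℕ} (ha : a < 4096) :
    a &&& s = a ↔ ∀ i : Fin 12, a.testBit i = true → s.testBit i = true := by
  constructor
  · intro h i hi
    rw [← h, Nat.testBit_land, Bool.and_eq_true] at hi
    exact hi.2
  · intro h
    apply Nat.eq_of_testBit_eq
    intro i
    rw [Nat.testBit_land]
    by_cases hi : i < 12
    · have := h ⟨i, hi⟩
      simp only at this
      cases h1 : a.testBit i <;> simp_all
    · have h2 : 2 ^ 12 ≤ 2 ^ i := Nat.pow_le_pow_right (by norm_num) (by omega)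
      rw [Nat.testBit_lt_two_pow (by omega)]
      rfl

theorem circ_sum {c : ℕ × ℕ × (Fin 12 → ℤ)} (hc : c ∈ circs) (l : E →L[ℝ] ℝ) (m : ℝ) :
    ∑ i, (c.2.2 i : ℝ) * (m - l (v i)) = 0 := by
  obtain ⟨h0, h1, -⟩ := chk_circ c hc
  have e : ∑ i, (c.2.2 i : ℝ) • v i = 0 := by
    ext k
    have := h1 k
    have h' : ((∑ i, c.2.2 i * vz i k : ℤ) : ℝ) = 0 := by exact_mod_cast this
    push_cast at h'
    simpa [v] using h'
  have e' := congrArg l e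
  simp only [map_sum, map_smul, smul_eq_mul, map_zero] at e'
  have h0' : ∑ i, (c.2.2 i : ℝ) = 0 := by exact_mod_cast h0
  simp only [mul_sub, Finset.sum_sub_distrib, ← Finset.sum_mul, h0', e']
  ring

theorem exposed_mem {F : Set E} (hne : F ≠ ∅) (hP : F ≠ P) (hF : IsExposed ℝ P F) :
    ∃ k, ∃ s ∈ L k, F = face s := by
  classical
  obtain ⟨l, hl⟩ := hF (Set.nonempty_iff_ne_empty.2 hne)
  obtain ⟨j, -, hj⟩ := Finset.exists_max_image Finset.univ (fun i => l (v i)) ⟨0, by simp⟩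
  set m := l (v j) with hm
  have hle : ∀ i, l (v i) ≤ m := fun i => hj i (by simp)
  set s := Nat.ofBits (fun i : Fin 12 => decide (l (v i) = m)) with hs
  have hidx : ∀ i, i ∈ idx s ↔ l (v i) = m := by
    intro i
    simp [idx, hs, Nat.testBit_ofBits_lt]
  have hlt : s < 4096 := Nat.ofBits_lt_two_pow _
  have hjs : j ∈ idx s := (hidx j).2 rfl
  have hFs : F = face s := by
    rw [hl]
    refine (argmax l m s (fun i hi => (hidx i).1 hi) (fun i hi => ?_) ⟨j, hjs⟩).symm
    exact lt_of_le_of_ne (hle i) (fun h => hi ((hidx i).2 h))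
  have hclosed : closedB s = true := by
    rw [closedB, List.all_eq_true]
    intro c hc
    obtain ⟨-, -, hpos, hneg, hlt1, hlt2⟩ := chk_circ c hc
    by_cases h1 : c.1 &&& s = c.1
    · have h2 : c.2.1 &&& s = c.2.1 := by
        rw [land_eq_of hlt1] at h1
        rw [land_eq_of hlt2]
        intro i hi
        have hsum := circ_sum hc l m
        have hnp : ∀ i ∈ Finset.univ, (c.2.2 i : ℝ) * (m - l (v i)) ≤ 0 := by
          intro i _
          by_cases hp : 0 < c.2.2 i
          · have := (hidx i).1 (h1 i ((hpos i).2 hp))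
            simp [this]
          · have : (c.2.2 i : ℝ) ≤ 0 := by exact_mod_cast not_lt.1 hp
            exact mul_nonpos_of_nonpos_of_nonneg this (sub_nonneg.2 (hle i))
        have hz := (Finset.sum_eq_zero_iff_of_nonpos hnp).1 hsum i (by simp)
        refine (hidx i).2 ?_
        have hci : (c.2.2 i : ℝ) ≠ 0 := by exact_mod_cast ((hneg i).1 hi).ne
        rcases mul_eq_zero.1 hz with h | h
        · exact absurd h hci
        · linarith
      simp [h2]
    · simp [h1]
  rcases chk_closed s hlt hclosed with h | h | h
  · exfalso
    rw [h] at hjs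
    simp [idx] at hjs
  · exfalso
    apply hP
    rw [hFs, h, face, P]
    congr 1
    have : idx 4095 = Set.univ := by
      ext i
      simp only [idx, Set.mem_ofPred_eq, Set.mem_univ, iff_true]
      revert i
      decide
    rw [this, Set.image_univ]
  · simp only [inL, Bool.or_eq_true, List.contains_iff_mem] at h
    rcases h with ((h | h) | h) | h
    exacts [⟨_, s, h, hFs⟩, ⟨_, s, h, hFs⟩, ⟨_, s, h, hFs⟩, ⟨_, s, h, hFs⟩]

theorem fVec_eq (k : Fin 4) : fVec (Set.range v) k = (L k).length := by
  have hset : {F : Set E | F ≠ ∅ ∧ F ≠ convexHull ℝ (Set.range v) ∧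
      IsExposed ℝ (convexHull ℝ (Set.range v)) F ∧ finrank ℝ (vectorSpan ℝ F) = (k : ℕ)} =
      face '' {s | s ∈ L k} := by
    ext F
    constructor
    · rintro ⟨h1, h2, h3, h4⟩
      obtain ⟨k', s, hs, rfl⟩ := exposed_mem h1 h2 h3
      rw [dm_eq hs] at h4
      obtain rfl := Fin.ext h4
      exact ⟨s, hs, rfl⟩
    · rintro ⟨s, hs, rfl⟩
      exact ⟨face_ne_empty hs, face_ne_P hs, face_exposed hs, dm_eq hs⟩
  rw [fVec, hset, Set.InjOn.ncard_image face_inj]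
  have : {s | s ∈ L k} = ((L k).toFinset : Set ℕ) := by ext; simp
  rw [this, Set.ncard_coe_finset, List.toFinset_card_of_nodup (chk_len.2.2.2.2 k)]

end Poly

/-- `(12,39,39,12)` is the f-vector of a convex 4-polytope. -/
theorem polytope_12_39_39_12 :
    ∃ V : Set (EuclideanSpace ℝ (Fin 4)), V.Finite ∧
      fVec V 0 = 12 ∧ fVec V 1 = 39 ∧ fVec V 2 = 39 ∧ fVec V 3 = 12 := by
  refine ⟨Set.range Poly.v, Set.finite_range _, ?_, ?_, ?_, ?_⟩
  · exact (Poly.fVec_eq 0).trans Poly.chk_len.1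
  · exact (Poly.fVec_eq 1).trans Poly.chk_len.2.1
  · exact (Poly.fVec_eq 2).trans Poly.chk_len.2.2.1
  · exact (Poly.fVec_eq 3).trans Poly.chk_len.2.2.2.1
end

section
/- Let L be the face family generated by the facet list F0={0,2,4,5,9}, F1={0,2,4,6,8}, F2={1,3,6,7,9}, F3={1,3,4,6,8}, F4={0,2,5,7,8}, F5={1,3,5,7,8}, F6={0,1,4,6,9}, F7={2,3,5,7,9}, F8={1,2,4,7,8}, F9={1,2,4,7,9}, F10={0,3,5,6,8,9} (subsets of Fin 10), ordered by inclusion. Then L is a lattice, graded of length 5, Eulerian, and its numbers of elements of rank 1, 2, 3, 4 are 10, 32, 33, 11 respectively; in particular (10,32,33,11) is the f-vector of an Eulerian lattice of length 5. -/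
/-- The face family generated by subsets `F 0, …, F (m-1)` of `Fin n`:
`Set.univ` together with all intersections over nonempty index sets. -/
def faceFamily {n m : ℕ} (F : Fin m → Set (Fin n)) : Set (Set (Fin n)) :=
  insert Set.univ {S | ∃ I : Set (Fin m), I.Nonempty ∧ S = ⋂ i ∈ I, F i}

/-- The facet list of the 3-sphere `(10⁰₍₃₂,₃₃₎)`. -/
def facets : Fin 11 → Set (Fin 10) :=
  ![{0,2,4,5,9}, {0,2,4,6,8}, {1,3,6,7,9}, {1,3,4,6,8}, {0,2,5,7,8},
    {1,3,5,7,8}, {0,1,4,6,9}, {2,3,5,7,9}, {1,2,4,7,8}, {1,2,4,7,9},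
    {0,3,5,6,8,9}]

namespace L1032

def E0 : List ℕ :=
  [0, 5, 10, 17, 18, 20, 33, 36, 40, 65, 66, 72, 80, 130, 132, 136, 160, 257, 258, 260, 264, 272,
  288, 320, 384, 513, 514, 516, 520, 528, 544, 576, 640,
  341, 346, 406, 421, 426, 565, 595, 662, 684, 714, 873]

def O0 : List ℕ :=
  [1, 2, 4, 8, 16, 32, 64, 128, 256, 512,
  21, 37, 74, 81, 82, 138, 150, 164, 168, 261, 266, 274, 276, 289, 296, 321, 328, 336, 386, 388,
  416, 529, 530, 532, 545, 548, 552, 577, 578, 584, 642, 644, 648, 1023]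

def L : List ℕ := E0 ++ O0

def fm : Fin 11 → ℕ := ![565, 341, 714, 346, 421, 426, 595, 684, 406, 662, 873]

/-- popcount -/
def pc (m : ℕ) : ℕ := (List.range 10).foldl (fun s i => s + m / 2 ^ i % 2) 0

def rkN (m : ℕ) : ℕ :=
  let p := pc m
  if p ≤ 2 then p else if p ≤ 4 then 3 else if p ≤ 6 then 4 else 5

def le (a b : ℕ) : Bool := Nat.beq (Nat.land a b) a
def lt (a b : ℕ) : Bool := le a b && !(Nat.beq a b)

def dec (m : ℕ) : Set (Fin 10) := {i | m.testBit i = true}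

theorem L_lt : ∀ m ∈ L, m < 1024 := by decide +kernel
theorem L_nodup : L.Nodup := by decide +kernel
theorem E_even : ∀ m ∈ E0, rkN m % 2 = 0 := by decide +kernel
theorem O_odd : ∀ m ∈ O0, rkN m % 2 = 1 := by decide +kernel
theorem L_closed : ∀ m ∈ L, ∀ i, m &&& fm i ∈ L := by decide +kernel
theorem L_inter : ∀ m ∈ L, m = 1023 ∨ ((∃ i, le m (fm i) = true) ∧
    ∀ x : Fin 10, (∀ i, le m (fm i) = true → (fm i).testBit x = true) → m.testBit x = true) := by
  decide +kernel
theorem L_cov : (L.all fun x => L.all fun y => !(lt x y) || Nat.beq (rkN y) (rkN x + 1) ||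
    L.any fun z => lt x z && lt z y) = true := by decide +kernel
theorem L_eul : (L.all fun x => L.all fun y => !(lt x y) ||
    Nat.beq (E0.filter fun z => le x z && le z y).length
      (O0.filter fun z => le x z && le z y).length) = true := by decide +kernel

theorem le_iff {a b : ℕ} (ha : a < 1024) : le a b = true ↔ dec a ⊆ dec b := by
  have h1 : le a b = true ↔ a &&& b = a := by
    unfold le; rw [Nat.beq_eq]; rfl
  rw [h1]
  constructor
  · intro h i hi
    simp only [dec, Set.mem_ofPred_eq] at *
    rw [← h, Nat.testBit_and] at hi
    simp at hi
    exact hi.2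
  · intro h
    apply Nat.eq_of_testBit_eq
    intro i
    rw [Nat.testBit_and]
    by_cases hi : i < 10
    · have := @h ⟨i, hi⟩
      simp only [dec, Set.mem_ofPred_eq] at this
      cases hh : a.testBit i
      · simp
      · simp [this hh]
    · have : a.testBit i = false := by
        apply Nat.testBit_lt_two_pow
        calc a < 2 ^ 10 := ha
          _ ≤ 2 ^ i := Nat.pow_le_pow_right (by norm_num) (by omega)
      simp [this]

theorem dec_inj {a b : ℕ} (ha : a < 1024) (hb : b < 1024) (h : dec a = dec b) : a = b := by
  have h1 := (le_iff (b := b) ha).2 h.le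
  have h2 := (le_iff (b := a) hb).2 h.ge
  unfold le at h1 h2
  rw [Nat.beq_eq] at h1 h2
  have h1' : a &&& b = a := h1
  have h2' : b &&& a = b := h2
  rw [Nat.and_comm] at h2'
  omega

theorem lt_iff {a b : ℕ} (ha : a < 1024) (hb : b < 1024) : lt a b = true ↔ dec a ⊂ dec b := by
  unfold lt
  rw [Bool.and_eq_true, le_iff ha, Set.ssubset_iff_subset_ne]
  refine and_congr_right fun _ => ?_
  simp only [Bool.not_eq_true', ne_eq]
  rw [← Bool.not_eq_true, Nat.beq_eq]
  exact not_congr ⟨fun h => h ▸ rfl, dec_inj ha hb⟩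

theorem dec_top : dec 1023 = Set.univ := by
  ext x; simp only [dec, Set.mem_ofPred_eq, Set.mem_univ, iff_true]; revert x; decide

theorem facets_eq (i : Fin 11) : facets i = dec (fm i) := by
  fin_cases i <;> ext x <;> simp [facets, dec, fm] <;> revert x <;> decide

theorem fam_of_finset (s : Finset (Fin 11)) : ∃ m ∈ L, dec m = ⋂ i ∈ s, facets i := by
  induction s using Finset.induction_on with
  | empty => exact ⟨1023, by decide, by simp [dec_top]⟩
  | insert a s _ ih =>
    obtain ⟨m, hm, h⟩ := ih
    refine ⟨m &&& fm a, L_closed m hm a, ?_⟩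
    rw [Finset.set_biInter_insert, ← h, facets_eq]
    ext x
    simp [dec, and_comm]

theorem mem_fam (S : Set (Fin 10)) : S ∈ faceFamily facets ↔ ∃ m ∈ L, dec m = S := by
  constructor
  · rintro (h | ⟨I, _, h⟩)
    · exact ⟨1023, by decide, by rw [dec_top, h]⟩
    · classical
      obtain ⟨m, hm, h'⟩ := fam_of_finset I.toFinset
      exact ⟨m, hm, by rw [h', h]; simp⟩
  · rintro ⟨m, hm, rfl⟩
    rcases L_inter m hm with h | ⟨⟨i, hi⟩, h⟩
    · left; rw [h, dec_top]
    · right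
      refine ⟨{i | le m (fm i) = true}, ⟨i, hi⟩, ?_⟩
      apply Set.Subset.antisymm
      · refine Set.subset_iInter₂ fun j hj => ?_
        rw [facets_eq]
        exact (le_iff (L_lt m hm)).1 hj
      · intro x hx
        refine h x fun j hj => ?_
        have := Set.mem_iInter₂.1 hx j hj
        rw [facets_eq] at this
        exact this

noncomputable def code (z : ↥(faceFamily facets)) : ℕ := ((mem_fam z.1).1 z.2).choose
theorem code_mem (z : ↥(faceFamily facets)) : code z ∈ L :=
  ((mem_fam z.1).1 z.2).choose_spec.1
theorem dec_code (z : ↥(faceFamily facets)) : dec (code z) = z.1 :=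
  ((mem_fam z.1).1 z.2).choose_spec.2
theorem exists_code {m : ℕ} (hm : m ∈ L) : ∃ z, code z = m := by
  refine ⟨⟨dec m, (mem_fam _).2 ⟨m, hm, rfl⟩⟩, ?_⟩
  exact dec_inj (L_lt _ (code_mem _)) (L_lt _ hm) (dec_code _)
theorem code_inj : Function.Injective code := fun a b h =>
  Subtype.ext (by rw [← dec_code a, ← dec_code b, h])
theorem code_le (a b : ↥(faceFamily facets)) : le (code a) (code b) = true ↔ a ≤ b := by
  rw [le_iff (L_lt _ (code_mem _)), dec_code, dec_code]; rfl
theorem code_lt (a b : ↥(faceFamily facets)) : lt (code a) (code b) = true ↔ a < b := by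
  rw [lt_iff (L_lt _ (code_mem _)) (L_lt _ (code_mem _)), dec_code, dec_code]; rfl

theorem count (l : List ℕ) (hl : l.Nodup) (hL : ∀ m ∈ l, m ∈ L)
    (P : Set ↥(faceFamily facets)) (q : ℕ → Bool)
    (h : ∀ z, z ∈ P ↔ (code z ∈ l ∧ q (code z) = true)) :
    P.ncard = (l.filter q).length := by
  rw [← Set.ncard_image_of_injective P code_inj,
    ← List.toFinset_card_of_nodup (hl.filter q), ← Set.ncard_coe_finset]
  congr 1
  ext m
  simp only [Set.mem_image, List.coe_toFinset, List.mem_filter, Set.mem_ofPred_eq]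
  constructor
  · rintro ⟨z, hz, rfl⟩
    exact (h z).1 hz
  · rintro ⟨h1, h2⟩
    obtain ⟨z, rfl⟩ := exists_code (hL m h1)
    exact ⟨z, (h z).2 ⟨h1, h2⟩, rfl⟩

theorem mem_E (z : ↥(faceFamily facets)) : Even (rkN (code z)) ↔ code z ∈ E0 := by
  rw [Nat.even_iff]
  refine ⟨fun h => ?_, E_even _⟩
  rcases List.mem_append.1 (code_mem z) with h1 | h1
  · exact h1
  · have := O_odd _ h1; omega

theorem mem_O (z : ↥(faceFamily facets)) : Odd (rkN (code z)) ↔ code z ∈ O0 := by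
  rw [Nat.odd_iff]
  refine ⟨fun h => ?_, O_odd _⟩
  rcases List.mem_append.1 (code_mem z) with h1 | h1
  · have := E_even _ h1; omega
  · exact h1

theorem rank_count (k : ℕ) : {z : ↥(faceFamily facets) | rkN (code z) = k}.ncard =
    (L.filter fun m => Nat.beq (rkN m) k).length :=
  count L L_nodup (fun _ h => h) _ _ fun z => by
    simp only [Set.mem_ofPred_eq, code_mem, true_and, Nat.beq_eq]

theorem inter_mem {S T : Set (Fin 10)} (hS : S ∈ faceFamily facets) (hT : T ∈ faceFamily facets) :
    S ∩ T ∈ faceFamily facets := by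
  rcases hS with rfl | ⟨I, hI, rfl⟩
  · simpa using hT
  rcases hT with rfl | ⟨J, hJ, rfl⟩
  · rw [Set.inter_univ]; exact Or.inr ⟨I, hI, rfl⟩
  · exact Or.inr ⟨I ∪ J, hI.inl, by rw [Set.biInter_union]⟩

theorem lub (a b : ↥(faceFamily facets)) : ∃ c : ↥(faceFamily facets), IsLUB {a, b} c := by
  have hmem : (⋂ i ∈ {i | a.1 ∪ b.1 ⊆ facets i}, facets i) ∈ faceFamily facets := by
    rcases Set.eq_empty_or_nonempty {i | a.1 ∪ b.1 ⊆ facets i} with h | h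
    · rw [h]; left; simp
    · exact Or.inr ⟨_, h, rfl⟩
  refine ⟨⟨_, hmem⟩, ?_, ?_⟩
  · rintro x (rfl | rfl)
    · exact Set.subset_iInter₂ fun i hi => Set.subset_union_left.trans hi
    · exact Set.subset_iInter₂ fun i hi => Set.subset_union_right.trans hi
  · intro c hc
    have ha : a.1 ⊆ c.1 := hc (by simp)
    have hb : b.1 ⊆ c.1 := hc (by simp)
    change _ ⊆ c.1
    rcases c.2 with h | ⟨I, _, h⟩
    · rw [h]; exact Set.subset_univ _
    · rw [h] at ha hb ⊢
      refine Set.biInter_subset_biInter_left fun i hi => ?_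
      exact Set.union_subset (ha.trans (Set.biInter_subset_of_mem hi))
        (hb.trans (Set.biInter_subset_of_mem hi))

theorem glb (a b : ↥(faceFamily facets)) : ∃ c : ↥(faceFamily facets), IsGLB {a, b} c := by
  refine ⟨⟨a.1 ∩ b.1, inter_mem a.2 b.2⟩, ?_, ?_⟩
  · rintro x (rfl | rfl)
    · exact Set.inter_subset_left
    · exact Set.inter_subset_right
  · intro c hc
    exact Set.subset_inter (hc (by simp)) (hc (by simp))

end L1032

open L1032

/-- The face family of `(10⁰₍₃₂,₃₃₎)`, ordered by inclusion, is a lattice,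
graded of length 5, Eulerian, and has 10, 32, 33, 11 elements of
rank 1, 2, 3, 4 respectively: `(10,32,33,11)` is the f-vector of an
Eulerian lattice of length 5. -/
theorem lattice_10_32_33_11 :
    (∀ a b : ↥(faceFamily facets), ∃ c : ↥(faceFamily facets), IsLUB {a, b} c) ∧
    (∀ a b : ↥(faceFamily facets), ∃ c : ↥(faceFamily facets), IsGLB {a, b} c) ∧
    ∃ rk : ↥(faceFamily facets) → ℕ,
      (∃ bot top : ↥(faceFamily facets),
        (∀ z, bot ≤ z ∧ z ≤ top) ∧ rk bot = 0 ∧ rk top = 5) ∧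
      (∀ x y : ↥(faceFamily facets), x ⋖ y → rk y = rk x + 1) ∧
      (∀ x y : ↥(faceFamily facets), x < y →
        {z ∈ Set.Icc x y | Even (rk z)}.ncard = {z ∈ Set.Icc x y | Odd (rk z)}.ncard) ∧
      {z | rk z = 1}.ncard = 10 ∧ {z | rk z = 2}.ncard = 32 ∧
      {z | rk z = 3}.ncard = 33 ∧ {z | rk z = 4}.ncard = 11 := by
  refine ⟨lub, glb, fun z => rkN (code z), ?_, ?_, ?_, ?_, ?_, ?_, ?_⟩
  · obtain ⟨b, hb⟩ := exists_code (m := 0) (by decide)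
    obtain ⟨t, ht⟩ := exists_code (m := 1023) (by decide)
    refine ⟨b, t, fun z => ⟨?_, ?_⟩, ?_, ?_⟩
    · rw [← code_le, hb, le_iff (by norm_num)]
      intro x hx; simp [dec] at hx
    · change z.1 ⊆ t.1
      rw [← dec_code t, ht, dec_top]; exact Set.subset_univ _
    · simp only [hb]; decide
    · simp only [ht]; decide
  · intro x y hxy
    have h := List.all_eq_true.1 (List.all_eq_true.1 L_cov _ (code_mem x)) _ (code_mem y)
    rw [(code_lt x y).2 hxy.lt] at h
    simp only [Bool.not_true, Bool.false_or, Bool.or_eq_true, Nat.beq_eq, List.any_eq_true,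
      Bool.and_eq_true] at h
    rcases h with h | ⟨m, hm, h1, h2⟩
    · exact h
    · obtain ⟨z, rfl⟩ := exists_code hm
      exact (hxy.2 ((code_lt _ _).1 h1) ((code_lt _ _).1 h2)).elim
  · intro x y hxy
    have h := List.all_eq_true.1 (List.all_eq_true.1 L_eul _ (code_mem x)) _ (code_mem y)
    rw [(code_lt x y).2 hxy] at h
    simp only [Bool.not_true, Bool.false_or, Nat.beq_eq] at h
    have hn := List.nodup_append.1 L_nodup
    rw [count E0 hn.1 (fun m hm => List.mem_append_left _ hm) _
        (fun z => le (code x) z && le z (code y)) ?_,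
      count O0 hn.2.1 (fun m hm => List.mem_append_right _ hm) _
        (fun z => le (code x) z && le z (code y)) ?_]
    · exact h
    · intro z
      simp only [Set.mem_ofPred_eq, Set.mem_Icc, mem_O, Bool.and_eq_true, code_le]
      exact and_comm
    · intro z
      simp only [Set.mem_ofPred_eq, Set.mem_Icc, mem_E, Bool.and_eq_true, code_le]
      exact and_comm
  · rw [rank_count]; decide +kernel
  · rw [rank_count]; decide +kernel
  · rw [rank_count]; decide +kernel
  · rw [rank_count]; decide +kernel
end
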